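/- arXiv:1207.4738 — 2 statements merged into one kernel-verified Lean document; each statement's English description precedes it below -/
import Mathlib

section
/- The symmetric group S_5 has exactly six Sylow 5-subgroups, and its action on this six-element set of Sylow 5-subgroups by conjugation is faithful and supertransitive: for every subset A of the set of Sylow 5-subgroups of S_5 and any two elements P, Q ∈ A, there exists g ∈ S_5 whose conjugation action preserves A setwise and sends P to Q. -/
namespace SylowFive

open Equiv MulAction

instance fact_prime_five : Fact (Nat.Prime 5) := ⟨Nat.prime_five⟩

/-- Generators of the six Sylow `5`-subgroups of `S₅`, labelled by the projective line over `𝔽₅`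
with `none` as the point at infinity. -/
def gen : Option (Fin 5) → Perm (Fin 5)
  | none => Equiv.addRight 1
  | some k => Equiv.addRight k * (swap 3 4 * Equiv.addRight 1 * swap 3 4) * (Equiv.addRight k)⁻¹

theorem orderOf_gen (x : Option (Fin 5)) : orderOf (gen x) = 5 :=
  orderOf_eq_prime (by revert x; decide +kernel) (by revert x; decide +kernel)

theorem factorization_card : (Nat.card (Perm (Fin 5))).factorization 5 = 1 := by
  have h : Nat.card (Perm (Fin 5)) = 5 * 24 := by
    simp [Nat.card_eq_fintype_card, Fintype.card_perm, Nat.factorial]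
  rw [h, Nat.factorization_mul (by norm_num) (by norm_num), Finsupp.add_apply,
    Nat.prime_five.factorization_self, Nat.factorization_eq_zero_of_not_dvd (by norm_num)]

theorem card_coe_sylow (P : Sylow 5 (Perm (Fin 5))) : Nat.card P = 5 := by
  rw [P.card_eq_multiplicity, factorization_card, pow_one]

/-- The Sylow `5`-subgroup generated by `gen x`. -/
noncomputable def point (x : Option (Fin 5)) : Sylow 5 (Perm (Fin 5)) :=
  Sylow.ofCard (Subgroup.zpowers (gen x)) <| by
    rw [factorization_card, pow_one, Nat.card_zpowers, orderOf_gen]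

theorem coe_point (x : Option (Fin 5)) :
    (point x : Subgroup (Perm (Fin 5))) = Subgroup.zpowers (gen x) :=
  Sylow.coe_ofCard _ _

theorem mem_point_iff {x : Option (Fin 5)} {g : Perm (Fin 5)} :
    g ∈ (point x : Subgroup (Perm (Fin 5))) ↔ ∃ n : Fin 5, gen x ^ (n : ℕ) = g := by
  rw [coe_point, mem_zpowers_iff_mem_range_orderOf, orderOf_gen]
  simp [Fin.exists_iff]

theorem eq_point_iff {x : Option (Fin 5)} {P : Sylow 5 (Perm (Fin 5))} :
    P = point x ↔ gen x ∈ (P : Subgroup (Perm (Fin 5))) := by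
  constructor
  · rintro rfl
    rw [coe_point]
    exact Subgroup.mem_zpowers _
  · intro h
    refine (Sylow.ext <| Subgroup.eq_of_le_of_card_ge ?_ ?_).symm
    · rwa [coe_point, Subgroup.zpowers_le]
    · rw [card_coe_sylow, card_coe_sylow]

theorem smul_point_eq_iff {g : Perm (Fin 5)} {x y : Option (Fin 5)} :
    g • point x = point y ↔ ∃ n : Fin 5, gen x ^ (n : ℕ) = g⁻¹ * gen y * g := by
  rw [eq_point_iff, Sylow.coe_subgroup_smul, Subgroup.mem_pointwise_smul_iff_inv_smul_mem,
    ← map_inv, MulAut.smul_def, MulAut.conj_apply, inv_inv, mem_point_iff]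

theorem point_injective : Function.Injective point := by
  intro x y h
  rw [eq_point_iff, mem_point_iff] at h
  revert x y
  decide +kernel

theorem card_sylow : Nat.card (Sylow 5 (Perm (Fin 5))) = 6 := by
  have hle : 6 ≤ Nat.card (Sylow 5 (Perm (Fin 5))) := by
    simpa using Nat.card_le_card_of_injective point point_injective
  have hmod := card_sylow_modEq_one 5 (Perm (Fin 5))
  have hdvd : Nat.card (Sylow 5 (Perm (Fin 5))) ∣ 24 := by
    have hindex := (point none).card_mul_index
    rw [card_coe_sylow, Nat.card_eq_fintype_card (α := Perm (Fin 5)), Fintype.card_perm,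
      Fintype.card_fin, show Nat.factorial 5 = 5 * 24 by rfl] at hindex
    rw [← Nat.eq_of_mul_eq_mul_left (by norm_num) hindex]
    exact (point none).card_dvd_index
  generalize Nat.card (Sylow 5 (Perm (Fin 5))) = n at *
  have hn := Nat.le_of_dvd (by norm_num) hdvd
  simp only [Nat.ModEq] at hmod
  interval_cases n <;> omega

theorem point_surjective : Function.Surjective point :=
  ((Nat.bijective_iff_injective_and_card point).2
    ⟨point_injective, by rw [card_sylow]; simp⟩).surjective

theorem eq_one_of_smul_eq {g : Perm (Fin 5)}
    (h : ∀ P : Sylow 5 (Perm (Fin 5)), g • P = P) : g = 1 := by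
  have h' : ∀ x, ∃ n : Fin 5, gen x ^ (n : ℕ) = g⁻¹ * gen x * g :=
    fun x => smul_point_eq_iff.1 (h (point x))
  clear h
  revert g
  decide +kernel

/-- The conjugation action is `2`-transitive, in the form that any pair of distinct points can be
moved to the pair labelled `∞` and `0`. -/
theorem exists_smul_eq_point {P Q : Sylow 5 (Perm (Fin 5))} (h : P ≠ Q) :
    ∃ g : Perm (Fin 5), g • P = point none ∧ g • Q = point (some 0) := by
  obtain ⟨g, hg⟩ := exists_smul_eq (Perm (Fin 5)) P (point none)
  obtain ⟨x, hx⟩ := point_surjective (g • Q)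
  cases x with
  | none => exact absurd (smul_left_cancel g (hg.trans hx)) h
  | some k =>
    refine ⟨(Equiv.addRight k)⁻¹ * g, ?_, ?_⟩
    · rw [mul_smul, hg, smul_point_eq_iff]
      clear hx
      revert k
      decide +kernel
    · rw [mul_smul, ← hx, smul_point_eq_iff]
      clear hx
      revert k
      decide +kernel

/-- The four elements interchanging `∞` and `0` are involutions, and any set containing both points
is preserved by one of them. -/
theorem exists_swap_of_mem {A : Set (Sylow 5 (Perm (Fin 5)))} (h : point none ∈ A)
    (h₀ : point (some 0) ∈ A) :
    ∃ g : Perm (Fin 5), (∀ X, X ∈ A ↔ g • X ∈ A) ∧ g • point none = point (some 0) := by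
  have key (g : Perm (Fin 5)) (v : Fin 5 → Option (Fin 5))
      (hv : ∀ x : Option (Fin 5), ∃ n : Fin 5,
        gen x ^ (n : ℕ) = g⁻¹ * gen (x.elim (some 0) v) * g)
      (hA : ∀ x : Option (Fin 5), point x ∈ A ↔ point (x.elim (some 0) v) ∈ A) :
      ∃ g : Perm (Fin 5), (∀ X, X ∈ A ↔ g • X ∈ A) ∧ g • point none = point (some 0) := by
    have hg (x : Option (Fin 5)) : g • point x = point (x.elim (some 0) v) :=
      smul_point_eq_iff.2 (hv x)
    refine ⟨g, fun X => ?_, hg none⟩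
    obtain ⟨x, rfl⟩ := point_surjective X
    rw [hg]
    exact hA x
  have k₁ := key (swap 3 4) ![none, some 2, some 1, some 4, some 3] (by decide +kernel)
  have k₂ := key (swap 0 2) ![none, some 3, some 4, some 1, some 2] (by decide +kernel)
  have k₃ := key (swap 0 3 * swap 2 4) ![none, some 1, some 3, some 2, some 4] (by decide +kernel)
  have k₄ := key (swap 0 4 * swap 2 3) ![none, some 4, some 2, some 3, some 1] (by decide +kernel)
  simp only [Option.forall, Fin.forall_fin_succ, Option.elim] at k₁ k₂ k₃ k₄
  simp [h, h₀] at k₁ k₂ k₃ k₄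
  by_cases h₁ : point (some 1) ∈ A <;> by_cases h₂ : point (some 2) ∈ A <;>
    by_cases h₃ : point (some 3) ∈ A <;> by_cases h₄ : point (some 4) ∈ A <;>
    simp only [h₁, h₂, h₃, h₄, iff_self, forall_const] at k₁ k₂ k₃ k₄ <;> assumption

end SylowFive

open SylowFive in

/-- `S₅` has exactly six Sylow `5`-subgroups, and its conjugation
action on them is faithful and supertransitive. -/
theorem stmt13 :
    Nat.card (Sylow 5 (Equiv.Perm (Fin 5))) = 6 ∧
    (∀ g : Equiv.Perm (Fin 5),
        (∀ P : Sylow 5 (Equiv.Perm (Fin 5)), g • P = P) → g = 1) ∧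
    (∀ A : Set (Sylow 5 (Equiv.Perm (Fin 5))), ∀ P ∈ A, ∀ Q ∈ A,
        ∃ g : Equiv.Perm (Fin 5),
          (∀ X : Sylow 5 (Equiv.Perm (Fin 5)), X ∈ A ↔ g • X ∈ A) ∧ g • P = Q) := by
  refine ⟨card_sylow, fun g => eq_one_of_smul_eq, fun A P hP Q hQ => ?_⟩
  rcases eq_or_ne P Q with rfl | hPQ
  · exact ⟨1, by simp, one_smul _ _⟩
  obtain ⟨h, hhP, hhQ⟩ := exists_smul_eq_point hPQ
  obtain ⟨g, hg, hgP⟩ := exists_swap_of_mem (A := {X | h⁻¹ • X ∈ A})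
    (by simpa [← hhP] using hP) (by simpa [← hhQ] using hQ)
  refine ⟨h⁻¹ * g * h, fun X => ?_, ?_⟩
  · simpa [mul_smul] using hg (h • X)
  · rw [mul_smul, mul_smul, hhP, hgP, ← hhQ, inv_smul_smul]
end

section
/- Let Ω be a finite set of players partitioned into k nonempty disjoint subsets Ω₁,…,Ω_k, and let G₂ = {π ∈ S_Ω : π(Ω_r) = Ω_r for all r = 1,…,k} be the group of all permutations preserving each block. Then the dimension of the affine space 𝒜_{G₂} of all G₂-symmetric quasi-values equals ( ∑_{r=1}^k |Ω_r|/(1+|Ω_r|) − 1 ) · ∏_{r=1}^k (1+|Ω_r|) + 1. In particular, for k = 2 this dimension equals |Ω₁| · |Ω₂|. -/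
open scoped BigOperators

/-- The space of cooperative games on player set `Ω`: real-valued functions on
coalitions vanishing on the empty coalition. -/
def GameSpace (Ω : Type*) [DecidableEq Ω] : Submodule ℝ (Finset Ω → ℝ) where
  carrier := {v | v ∅ = 0}
  add_mem' := by
    intro a b ha hb
    simp only [Set.mem_setOf_eq, Pi.add_apply] at *
    simp [ha, hb]
  zero_mem' := rfl
  smul_mem' := by
    intro c v hv
    simp only [Set.mem_setOf_eq, Pi.smul_apply] at *
    simp [hv]

/-- A (linear) game value: a linear operator from games to payoff vectors. -/
abbrev GameValue (Ω : Type*) [DecidableEq Ω] := GameSpace Ω →ₗ[ℝ] (Ω → ℝ)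

/-- Player `i` is a null player of the game `v`: `v(R ∪ {i}) = v(R)` for all `R`. -/
def IsNullPlayer {Ω : Type*} [DecidableEq Ω] (i : Ω) (v : GameSpace Ω) : Prop :=
  ∀ R : Finset Ω, (v : Finset Ω → ℝ) (insert i R) = (v : Finset Ω → ℝ) R

/-- A quasi-value: a linear game value satisfying the null-player property and
efficiency. -/
def IsQuasiValue {Ω : Type*} [Fintype Ω] [DecidableEq Ω] (φ : GameValue Ω) : Prop :=
  (∀ (v : GameSpace Ω) (i : Ω), IsNullPlayer i v → φ v i = 0) ∧
  (∀ v : GameSpace Ω, ∑ i, φ v i = (v : Finset Ω → ℝ) Finset.univ)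

/-- The action of a permutation on a game: `(g • v)(R) = v(g⁻¹(R))`. -/
def permGame {Ω : Type*} [DecidableEq Ω] (g : Equiv.Perm Ω) (v : GameSpace Ω) :
    GameSpace Ω :=
  ⟨fun R => (v : Finset Ω → ℝ) (R.image (g⁻¹ : Equiv.Perm Ω)), by
    show (v : Finset Ω → ℝ) ((∅ : Finset Ω).image (g⁻¹ : Equiv.Perm Ω)) = 0
    rw [Finset.image_empty]
    exact v.2⟩

/-- `φ` is symmetric with respect to all permutations in `G`:
`φ(g • v) = g • φ(v)`, i.e. `φ(g • v)ᵢ = φ(v)_{g⁻¹ i}` for all `g ∈ G`. -/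
def IsGSym {Ω : Type*} [DecidableEq Ω] (G : Subgroup (Equiv.Perm Ω))
    (φ : GameValue Ω) : Prop :=
  ∀ g ∈ G, ∀ (v : GameSpace Ω) (i : Ω), φ (permGame g v) i = φ v (g⁻¹ i)

/-- The unanimity game `u_R` for a nonempty coalition `R`. -/
def unanimity {Ω : Type*} [DecidableEq Ω] (R : Finset Ω) (hR : R.Nonempty) :
    GameSpace Ω :=
  ⟨fun S => if R ⊆ S then (1 : ℝ) else 0, by
    show (if R ⊆ (∅ : Finset Ω) then (1 : ℝ) else 0) = 0
    simp [Finset.subset_empty, hR.ne_empty]⟩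

/-- The "caste" group: all permutations preserving each block `P r` setwise. -/
def casteGroup {Ω : Type*} [DecidableEq Ω] {k : ℕ} (P : Fin k → Finset Ω) :
    Subgroup (Equiv.Perm Ω) where
  carrier := {π | ∀ r, (P r).image π = P r}
  one_mem' := by intro r; simp
  mul_mem' := by
    intro a b ha hb r
    rw [Equiv.Perm.coe_mul, ← Finset.image_image, hb r, ha r]
  inv_mem' := by
    intro a ha r
    conv_lhs => rw [← ha r]
    rw [Finset.image_image]
    have h : (⇑a⁻¹ ∘ ⇑a) = id := by funext x; simp
    rw [h, Finset.image_id]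

namespace QuasiValue

open Finset

variable {Ω κ : Type*} [DecidableEq Ω]

omit [DecidableEq Ω] in
lemma nonempty_of_mem {R : Finset Ω} {i : Ω} (h : i ∈ R) : R.Nonempty := ⟨i, h⟩

lemma isNullPlayer_unanimity {R : Finset Ω} (hR : R.Nonempty) {i : Ω} (hi : i ∉ R) :
    IsNullPlayer i (unanimity R hR) := by
  intro S
  simp [unanimity, subset_insert_iff_of_notMem hi]

lemma permGame_unanimity (g : Equiv.Perm Ω) (R : Finset Ω) (hR : R.Nonempty) :
    permGame g (unanimity R hR) = unanimity (R.image g) (hR.image g) := by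
  refine Subtype.ext (funext fun S => ?_)
  have h : R ⊆ S.image (g⁻¹ : Equiv.Perm Ω) ↔ R.image g ⊆ S := by
    rw [← image_subset_image_iff (s := R) g.injective, image_image]
    simp
  simp only [permGame, unanimity, h]

/-- The zeta transform `(Z m)(S) = ∑_{R ⊆ S} m(R)` on set functions. -/
def zeta (Ω : Type*) [DecidableEq Ω] : (Finset Ω → ℝ) →ₗ[ℝ] (Finset Ω → ℝ) where
  toFun m S := ∑ R ∈ S.powerset, m R
  map_add' m m' := by ext S; simp [sum_add_distrib]
  map_smul' c m := by ext S; simp [mul_sum]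

lemma eq_of_sum_powerset_eq {m m' : Finset Ω → ℝ}
    (h : ∀ S : Finset Ω, ∑ R ∈ S.powerset, m R = ∑ R ∈ S.powerset, m' R) :
    m = m' := by
  funext S
  induction S using Finset.strongInduction with
  | H S ih =>
    have h1 := h S
    rw [← add_sum_erase _ _ (mem_powerset_self S),
      ← add_sum_erase _ _ (mem_powerset_self S)] at h1
    have h2 : ∑ R ∈ S.powerset.erase S, m R = ∑ R ∈ S.powerset.erase S, m' R := by
      refine sum_congr rfl fun R hR => ih R ?_
      rw [mem_erase, mem_powerset] at hR
      exact lt_of_le_of_ne hR.2 hR.1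
    linarith

lemma zeta_injective : Function.Injective (zeta Ω) := fun _ _ h =>
  eq_of_sum_powerset_eq fun S => congrFun h S

variable [Fintype Ω]

/-- The Harsanyi dividends of a game: the coordinates in the basis of unanimity games. -/
noncomputable def dividend : GameSpace Ω →ₗ[ℝ] (Finset Ω → ℝ) :=
  (LinearEquiv.ofInjectiveEndo (zeta Ω) zeta_injective).symm.toLinearMap ∘ₗ (GameSpace Ω).subtype

lemma sum_dividend (v : GameSpace Ω) (S : Finset Ω) :
    ∑ R ∈ S.powerset, dividend v R = (v : Finset Ω → ℝ) S :=
  congrFun ((LinearEquiv.ofInjectiveEndo (zeta Ω) zeta_injective).apply_symm_apply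
    (v : Finset Ω → ℝ)) S

lemma dividend_eq {v : GameSpace Ω} {m : Finset Ω → ℝ}
    (h : ∀ S : Finset Ω, ∑ R ∈ S.powerset, m R = (v : Finset Ω → ℝ) S) : dividend v = m :=
  eq_of_sum_powerset_eq fun S => (sum_dividend v S).trans (h S).symm

lemma dividend_empty (v : GameSpace Ω) : dividend v ∅ = 0 := by
  have h := sum_dividend v ∅
  rw [powerset_empty, sum_singleton] at h
  exact h.trans v.2

lemma dividend_unanimity {R : Finset Ω} (hR : R.Nonempty) (S : Finset Ω) :
    dividend (unanimity R hR) S = if S = R then 1 else 0 := by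
  refine congrFun (dividend_eq (m := fun S => if S = R then 1 else 0) fun S => ?_) S
  simp [unanimity]

lemma dividend_eq_zero_of_isNullPlayer {v : GameSpace Ω} {i : Ω} (h : IsNullPlayer i v) :
    ∀ R : Finset Ω, i ∈ R → dividend v R = 0 := by
  have key : dividend v = fun R => if i ∈ R then 0 else dividend v R := by
    refine dividend_eq fun S => ?_
    rw [sum_ite, sum_const_zero, zero_add]
    have h1 : (v : Finset Ω → ℝ) S = (v : Finset Ω → ℝ) (S.erase i) := by
      by_cases hi : i ∈ S
      · rw [← h (S.erase i), insert_erase hi]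
      · rw [erase_eq_of_notMem hi]
    rw [h1, ← sum_dividend v]
    refine sum_congr ?_ fun _ _ => rfl
    ext R
    simp only [mem_filter, mem_powerset, subset_erase]
  intro R hR
  rw [key]
  simp [hR]

lemma dividend_permGame (g : Equiv.Perm Ω) (v : GameSpace Ω) (R : Finset Ω) :
    dividend (permGame g v) (R.image g) = dividend v R := by
  have h : dividend (permGame g v) = fun R => dividend v (R.image (g⁻¹ : Equiv.Perm Ω)) := by
    refine dividend_eq fun S => ?_
    change _ = (v : Finset Ω → ℝ) (S.image (g⁻¹ : Equiv.Perm Ω))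
    rw [← sum_dividend v, powerset_image, sum_image]
    exact (image_injective (g⁻¹ : Equiv.Perm Ω).injective).injOn
  rw [h]
  simp [image_image]

lemma dividend_sum_unanimity (v : GameSpace Ω) :
    v = ∑ R, dividend v R • (if h : R.Nonempty then unanimity R h else 0) := by
  refine Subtype.ext (funext fun S => ?_)
  rw [← sum_dividend v S, Submodule.coe_sum, Finset.sum_apply]
  rw [← sum_subset (subset_univ S.powerset)]
  · refine sum_congr rfl fun R hR => ?_
    split_ifs with h
    · simp [unanimity, mem_powerset.1 hR]
    · rw [not_nonempty_iff_eq_empty.1 h, dividend_empty]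
      simp
  · intro R _ hR
    rw [mem_powerset] at hR
    split_ifs with h
    · simp [unanimity, hR]
    · simp

lemma apply_eq_sum_unanimity {φ : GameValue Ω}
    (hφ : ∀ (v : GameSpace Ω) (i : Ω), IsNullPlayer i v → φ v i = 0) (v : GameSpace Ω) (i : Ω) :
    φ v i = ∑ R, if h : i ∈ R then dividend v R * φ (unanimity R (nonempty_of_mem h)) i else 0 := by
  conv_lhs => rw [dividend_sum_unanimity v]
  rw [map_sum, Finset.sum_apply]
  refine sum_congr rfl fun R _ => ?_
  by_cases hi : i ∈ R
  · simp [hi, show R.Nonempty from ⟨i, hi⟩]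
  · rw [dif_neg hi]
    split_ifs with h
    · simp [hφ _ _ (isNullPlayer_unanimity h hi)]
    · simp

variable [DecidableEq κ]

/-- The block `{i | b i = r}` of players of caste `r`. -/
abbrev block (b : Ω → κ) (r : κ) : Finset Ω := univ.filter (b · = r)

/-- The possible numbers of members of each caste in a coalition. -/
abbrev Profile (b : Ω → κ) : Type _ := ∀ r : κ, Fin ((block b r).card + 1)

/-- The number of members of each caste in the coalition `R`. -/
def profile (b : Ω → κ) (R : Finset Ω) : Profile b := fun r =>
  ⟨(R.filter (b · = r)).card, Nat.lt_succ_of_le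
    (card_le_card (filter_subset_filter _ (subset_univ R)))⟩

omit [DecidableEq Ω] in
lemma profile_ne_zero {b : Ω → κ} {R : Finset Ω} {i : Ω} (hi : i ∈ R) :
    profile b R (b i) ≠ 0 := by
  intro h
  have h' : (R.filter (b · = b i)).card = 0 := congrArg Fin.val h
  rw [card_eq_zero] at h'
  have : i ∈ R.filter (b · = b i) := by simp [hi]
  simp [h'] at this

omit [DecidableEq Ω] in
lemma profile_empty (b : Ω → κ) : profile b ∅ = 0 := by
  refine funext fun r => Fin.ext ?_
  simp [profile]

lemma profile_surjective (b : Ω → κ) : Function.Surjective (profile b) := by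
  intro t
  choose S hS hc using fun r => exists_subset_card_eq (Nat.le_of_lt_succ (t r).2)
  refine ⟨univ.filter fun i => i ∈ S (b i), funext fun r => Fin.ext ?_⟩
  rw [← hc r]
  change (filter _ _).card = _
  congr 1
  ext i
  simp only [mem_filter, mem_univ, true_and]
  constructor
  · rintro ⟨h, rfl⟩
    exact h
  · intro h
    have := hS r h
    simp only [mem_filter, mem_univ, true_and] at this
    subst this
    exact ⟨h, rfl⟩

omit [DecidableEq Ω] in
lemma exists_mem_of_profile_ne_zero {b : Ω → κ} {R : Finset Ω} {r : κ}
    (h : profile b R r ≠ 0) : ∃ i ∈ R, b i = r := by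
  have h' : (R.filter (b · = r)).card ≠ 0 := fun h0 => h (Fin.ext h0)
  obtain ⟨i, hi⟩ := card_ne_zero.1 h'
  exact ⟨i, mem_filter.1 hi⟩

lemma profile_image {b : Ω → κ} {g : Equiv.Perm Ω} (hg : ∀ i, b (g i) = b i) (R : Finset Ω) :
    profile b (R.image g) = profile b R := by
  refine funext fun r => Fin.ext ?_
  change (filter _ _).card = (filter _ _).card
  rw [filter_image, card_image_of_injective _ g.injective]
  simp only [hg]

lemma exists_perm_image_eq {b : Ω → κ} {R R' : Finset Ω} (h : profile b R = profile b R') :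
    ∃ g : Equiv.Perm Ω, (∀ i, b (g i) = b i) ∧ ∀ i, g i ∈ R' ↔ i ∈ R := by
  have hc : ∀ r, (R.filter (b · = r)).card = (R'.filter (b · = r)).card := fun r =>
    congrArg Fin.val (congrFun h r)
  have hc' : ∀ r, (Rᶜ.filter (b · = r)).card = (R'ᶜ.filter (b · = r)).card := by
    have aux : ∀ (S : Finset Ω) r,
        (S.filter (b · = r)).card + (Sᶜ.filter (b · = r)).card = (block b r).card := by
      intro S r
      rw [← card_union_of_disjoint (disjoint_filter_filter disjoint_compl_right),
        ← filter_union, union_compl]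
    intro r
    have h1 := aux R r
    have h2 := aux R' r
    have h3 := hc r
    omega
  have he : ∀ c : κ × Prop,
      Nonempty ({i // (b i, i ∈ R) = c} ≃ {i // (b i, i ∈ R') = c}) := by
    classical
    rintro ⟨r, p⟩
    refine Fintype.card_eq.1 ?_
    rw [Fintype.card_subtype, Fintype.card_subtype]
    by_cases hp : p
    · convert hc r using 2 <;> ext i <;> simp [hp, and_comm]
    · convert hc' r using 2 <;> ext i <;> simp [hp, and_comm]
  let g : Equiv.Perm Ω := Equiv.ofFiberEquiv (f := fun i => (b i, i ∈ R))
    (g := fun i => (b i, i ∈ R')) fun c => (he c).some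
  have hg : ∀ i, (b (g i), g i ∈ R') = (b i, i ∈ R) := fun i => 
    Equiv.ofFiberEquiv_map (f := fun i => (b i, i ∈ R)) (g := fun i => (b i, i ∈ R')) _ i
  exact ⟨g, fun i => congrArg Prod.fst (hg i), fun i => iff_of_eq (congrArg Prod.snd (hg i))⟩

lemma exists_perm_image_eq_apply_eq {b : Ω → κ} {R R' : Finset Ω}
    (h : profile b R = profile b R') {i i' : Ω} (hi : i ∈ R) (hi' : i' ∈ R') (hb : b i = b i') :
    ∃ g : Equiv.Perm Ω, (∀ j, b (g j) = b j) ∧ R.image g = R' ∧ g i = i' := by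
  obtain ⟨g, hg, hR⟩ := exists_perm_image_eq h
  have hgi : g i ∈ R' := (hR i).2 hi
  have hbi : b (g i) = b i' := (hg i).trans hb
  have hmem : ∀ j, Equiv.swap (g i) i' j ∈ R' ↔ j ∈ R' := by
    intro j
    rw [Equiv.swap_apply_def]
    split_ifs with h1 h2
    · simp [h1, hgi, hi']
    · simp [h2, hgi, hi']
    · rfl
  refine ⟨Equiv.swap (g i) i' * g, fun j => ?_, ?_, by simp⟩
  · rw [Equiv.Perm.mul_apply, ← hg j, Equiv.swap_apply_def]
    split_ifs with h1 h2
    · rw [h1, hbi]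
    · rw [h2, hbi]
    · rfl
  · ext j
    constructor
    · intro hj
      obtain ⟨l, hl, rfl⟩ := mem_image.1 hj
      rw [Equiv.Perm.mul_apply, hmem, hR]
      exact hl
    · intro hj
      refine mem_image.2 ⟨(Equiv.swap (g i) i' * g).symm j, ?_, Equiv.apply_symm_apply _ j⟩
      rw [← hR, ← hmem, ← Equiv.Perm.mul_apply, Equiv.apply_symm_apply]
      exact hj

/-- The pairs of a profile and a caste which is represented in it. -/
abbrev Share (b : Ω → κ) : Type _ := {p : Profile b × κ // p.1 p.2 ≠ 0}

/-- Extension by zero of a function on `Share b`. -/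
def share {b : Ω → κ} (d : Share b → ℝ) (t : Profile b) (r : κ) : ℝ :=
  if h : t r ≠ 0 then d ⟨(t, r), h⟩ else 0

omit [DecidableEq Ω] in
@[simp] lemma share_add {b : Ω → κ} (d d' : Share b → ℝ) (t : Profile b) (r : κ) :
    share (d + d') t r = share d t r + share d' t r := by
  unfold share; split_ifs <;> simp

omit [DecidableEq Ω] in
@[simp] lemma share_smul {b : Ω → κ} (c : ℝ) (d : Share b → ℝ) (t : Profile b) (r : κ) :
    share (c • d) t r = c * share d t r := by
  unfold share; split_ifs <;> simp

/-- The game value that distributes the dividend of each coalition `R` according to the shares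
`d`, each member of `R` being paid according to their caste. -/
noncomputable def shareValue (b : Ω → κ) : (Share b → ℝ) →ₗ[ℝ] GameValue Ω :=
  LinearMap.mk₂ ℝ
    (fun d v i => ∑ R : Finset Ω, if i ∈ R then dividend v R * share d (profile b R) (b i) else 0)
    (fun d d' v => by
      ext i
      simp only [Pi.add_apply, ← sum_add_distrib]
      refine sum_congr rfl fun R _ => ?_
      split_ifs <;> simp [mul_add])
    (fun c d v => by
      ext i
      simp only [Pi.smul_apply, smul_eq_mul, mul_sum]
      refine sum_congr rfl fun R _ => ?_
      split_ifs <;> simp [mul_left_comm])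
    (fun d v v' => by
      ext i
      simp only [Pi.add_apply, ← sum_add_distrib]
      refine sum_congr rfl fun R _ => ?_
      split_ifs <;> simp [add_mul])
    (fun c d v => by
      ext i
      simp only [Pi.smul_apply, smul_eq_mul, mul_sum]
      refine sum_congr rfl fun R _ => ?_
      split_ifs <;> simp [mul_assoc])

lemma shareValue_apply (b : Ω → κ) (d : Share b → ℝ) (v : GameSpace Ω) (i : Ω) :
    shareValue b d v i =
      ∑ R : Finset Ω, if i ∈ R then dividend v R * share d (profile b R) (b i) else 0 :=
  rfl

lemma shareValue_unanimity (b : Ω → κ) (d : Share b → ℝ) {R : Finset Ω} (hR : R.Nonempty) {i : Ω}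
    (hi : i ∈ R) : shareValue b d (unanimity R hR) i = share d (profile b R) (b i) := by
  rw [shareValue_apply, sum_eq_single R]
  · simp [hi, dividend_unanimity]
  · intro S _ hS
    simp [dividend_unanimity, hS]
  · simp

lemma shareValue_injective (b : Ω → κ) : Function.Injective (shareValue b) := by
  intro d d' h
  funext ⟨⟨t, r⟩, ht⟩
  obtain ⟨R, rfl⟩ := profile_surjective b t
  obtain ⟨i, hi, rfl⟩ := exists_mem_of_profile_ne_zero ht
  have h1 := shareValue_unanimity b d (nonempty_of_mem hi) hi
  rw [h, shareValue_unanimity b d' _ hi] at h1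
  simpa [share, profile_ne_zero hi] using h1.symm

lemma shareValue_eq_zero_of_isNullPlayer (b : Ω → κ) (d : Share b → ℝ) (v : GameSpace Ω) (i : Ω)
    (h : IsNullPlayer i v) : shareValue b d v i = 0 := by
  rw [shareValue_apply]
  refine sum_eq_zero fun R _ => ?_
  split_ifs with hi
  · rw [dividend_eq_zero_of_isNullPlayer h R hi, zero_mul]
  · rfl

lemma shareValue_permGame (b : Ω → κ) (d : Share b → ℝ) {g : Equiv.Perm Ω}
    (hg : ∀ i, b (g i) = b i) (v : GameSpace Ω) (i : Ω) :
    shareValue b d (permGame g v) (g i) = shareValue b d v i := by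
  rw [shareValue_apply, shareValue_apply]
  refine (Fintype.sum_equiv (Equiv.finsetCongr g) _ _ fun R => ?_).symm
  have hR : Equiv.finsetCongr g R = R.image g := by
    ext j
    rw [Equiv.finsetCongr_apply, map_eq_image]
    rfl
  rw [hR, dividend_permGame, profile_image hg, hg]
  simp

lemma exists_shareValue_eq (b : Ω → κ) {φ : GameValue Ω}
    (hnull : ∀ (v : GameSpace Ω) (i : Ω), IsNullPlayer i v → φ v i = 0)
    (hsym : ∀ g : Equiv.Perm Ω, (∀ i, b (g i) = b i) →
      ∀ (v : GameSpace Ω) (i : Ω), φ (permGame g v) (g i) = φ v i) :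
    ∃ d, shareValue b d = φ := by
  choose R hR using profile_surjective b
  have hex : ∀ p : Share b, ∃ i ∈ R p.1.1, b i = p.1.2 := fun p =>
    exists_mem_of_profile_ne_zero (by rw [hR]; exact p.2)
  choose i hi hbi using hex
  refine ⟨fun p => φ (unanimity (R p.1.1) (nonempty_of_mem (hi p))) (i p), ?_⟩
  refine LinearMap.ext fun v => funext fun j => ?_
  rw [apply_eq_sum_unanimity hnull, shareValue_apply]
  refine sum_congr rfl fun S _ => ?_
  split_ifs with hj
  · have hp : profile b S (b j) ≠ 0 := profile_ne_zero hj
    obtain ⟨g, hg, hgR, hgi⟩ := exists_perm_image_eq_apply_eq (hR (profile b S))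
      (hi ⟨(profile b S, b j), hp⟩) hj (hbi ⟨(profile b S, b j), hp⟩)
    simp only [share, hp, ne_eq, not_false_eq_true, dite_true]
    rw [← hsym g hg, hgi]
    congr 3
    rw [permGame_unanimity]
    simp only [hgR]
  · rfl

variable [Fintype κ]

/-- The total payoff distributed within a coalition of given nonzero profile. -/
def totalShare (b : Ω → κ) : (Share b → ℝ) →ₗ[ℝ] ({t : Profile b // t ≠ 0} → ℝ) where
  toFun d t := ∑ r, ((t.1 r : ℕ) : ℝ) * share d t.1 r
  map_add' d d' := by ext t; simp [mul_add, sum_add_distrib]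
  map_smul' c d := by ext t; simp [mul_sum, mul_left_comm]

lemma sum_shareValue (b : Ω → κ) (d : Share b → ℝ) (v : GameSpace Ω) :
    ∑ i, shareValue b d v i = ∑ R : Finset Ω, dividend v R *
      ∑ r, ((profile b R r : ℕ) : ℝ) * share d (profile b R) r := by
  simp only [shareValue_apply]
  rw [sum_comm]
  refine sum_congr rfl fun R _ => ?_
  rw [← sum_filter, filter_mem_eq_inter, univ_inter, ← mul_sum, ← sum_fiberwise R b]
  congr 1
  refine sum_congr rfl fun r _ => ?_
  rw [sum_congr rfl (g := fun _ => share d (profile b R) r), sum_const, nsmul_eq_mul]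
  · rfl
  · intro i hi
    rw [(mem_filter.1 hi).2]

lemma efficient_shareValue_iff (b : Ω → κ) (d : Share b → ℝ) :
    (∀ v : GameSpace Ω, ∑ i, shareValue b d v i = (v : Finset Ω → ℝ) univ) ↔
      totalShare b d = 1 := by
  simp only [sum_shareValue]
  constructor
  · intro h
    funext ⟨t, ht⟩
    obtain ⟨R, rfl⟩ := profile_surjective b t
    have hR : R.Nonempty := by
      rw [nonempty_iff_ne_empty]
      rintro rfl
      exact ht (profile_empty b)
    have h1 := h (unanimity R hR)
    rw [sum_eq_single R] at h1
    · rw [dividend_unanimity, if_pos rfl, one_mul] at h1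
      exact h1.trans (if_pos (subset_univ R))
    · intro S _ hS
      simp [dividend_unanimity, hS]
    · simp
  · intro h v
    rw [← sum_dividend v, powerset_univ]
    refine sum_congr rfl fun R _ => ?_
    by_cases hR : profile b R = 0
    · have : R = ∅ := by
        by_contra hne
        obtain ⟨i, hi⟩ := nonempty_iff_ne_empty.2 hne
        exact profile_ne_zero (b := b) hi (congrFun hR _)
      rw [this, dividend_empty, zero_mul]
    · have h1 := congrFun h ⟨profile b R, hR⟩
      change ∑ r, ((profile b R r : ℕ) : ℝ) * share d (profile b R) r = 1 at h1
      rw [h1, mul_one]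

omit [DecidableEq Ω] in
lemma totalShare_surjective (b : Ω → κ) : Function.Surjective (totalShare b) := by
  intro x
  refine ⟨fun p => x ⟨p.1.1, fun h => p.2 (congrFun h _)⟩ / ∑ r, ((p.1.1 r : ℕ) : ℝ), ?_⟩
  funext ⟨t, ht⟩
  obtain ⟨r₀, hr₀⟩ := Function.ne_iff.1 ht
  have hpos : (∑ r, ((t r : ℕ) : ℝ)) ≠ 0 := by
    refine (sum_pos' (fun r _ => Nat.cast_nonneg _) ⟨r₀, mem_univ _, ?_⟩).ne'
    exact_mod_cast Nat.pos_of_ne_zero fun h => hr₀ (Fin.ext h)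
  change ∑ r, ((t r : ℕ) : ℝ) * share _ t r = x ⟨t, ht⟩
  rw [sum_congr rfl (g := fun r => ((t r : ℕ) : ℝ) * (x ⟨t, ht⟩ / ∑ r, ((t r : ℕ) : ℝ))),
    ← sum_mul, mul_div_cancel₀ _ hpos]
  intro r _
  by_cases h : t r = 0
  · simp [h]
  · simp [share, h]

lemma setOf_isQuasiValue_symmetric_eq_image (b : Ω → κ) :
    {φ : GameValue Ω | IsQuasiValue φ ∧ ∀ g : Equiv.Perm Ω, (∀ i, b (g i) = b i) →
      ∀ (v : GameSpace Ω) (i : Ω), φ (permGame g v) (g i) = φ v i} =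
      shareValue b '' {d | totalShare b d = 1} := by
  ext φ
  constructor
  · rintro ⟨⟨hnull, heff⟩, hsym⟩
    obtain ⟨d, rfl⟩ := exists_shareValue_eq b hnull hsym
    exact ⟨d, (efficient_shareValue_iff b d).1 heff, rfl⟩
  · rintro ⟨d, hd, rfl⟩
    exact ⟨⟨shareValue_eq_zero_of_isNullPlayer b d, (efficient_shareValue_iff b d).2 hd⟩,
      fun g hg => shareValue_permGame b d hg⟩

lemma vectorSpan_fiber {K V W : Type*} [Field K] [AddCommGroup V] [Module K V] [AddCommGroup W]
    [Module K W] (f : V →ₗ[K] W) (x₀ : V) :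
    vectorSpan K {x | f x = f x₀} = LinearMap.ker f := by
  refine le_antisymm (Submodule.span_le.2 ?_) fun x hx => ?_
  · rintro _ ⟨x, hx, y, hy, rfl⟩
    simp only [Set.mem_ofPred_eq] at hx hy
    simp [hx, hy]
  · have h := vsub_mem_vectorSpan K (s := {x | f x = f x₀}) (p₁ := x + x₀) (p₂ := x₀)
      (by simpa using hx) rfl
    simpa using h

lemma finrank_direction_add_card (b : Ω → κ) :
    Module.finrank ℝ (affineSpan ℝ (shareValue b '' {d | totalShare b d = 1})).direction +
      Fintype.card {t : Profile b // t ≠ 0} = Fintype.card (Share b) := by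
  obtain ⟨d₀, hd₀⟩ := totalShare_surjective b 1
  rw [direction_affineSpan, ← hd₀]
  have h : vectorSpan ℝ (shareValue b '' {d | totalShare b d = totalShare b d₀}) =
      (LinearMap.ker (totalShare b)).map (shareValue b) := by
    rw [← vectorSpan_fiber (totalShare b) d₀]
    exact (shareValue b).toAffineMap.map_vectorSpan.symm
  rw [h, ← (Submodule.equivMapOfInjective _ (shareValue_injective b) _).finrank_eq]
  have h1 := LinearMap.finrank_range_add_finrank_ker (totalShare b)
  rw [LinearMap.range_eq_top.2 (totalShare_surjective b), finrank_top,
    Module.finrank_fintype_fun_eq_card, Module.finrank_fintype_fun_eq_card] at h1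
  omega

omit [DecidableEq Ω] in
lemma card_profile (b : Ω → κ) :
    (Fintype.card (Profile b) : ℝ) = ∏ r, (1 + ((block b r).card : ℝ)) := by
  simp [Fintype.card_pi, add_comm]

omit [DecidableEq Ω] in
lemma card_profile_ne_zero (b : Ω → κ) :
    (Fintype.card {t : Profile b // t ≠ 0} : ℝ) = ∏ r, (1 + ((block b r).card : ℝ)) - 1 := by
  rw [← card_profile, Fintype.card_subtype_compl, Fintype.card_subtype_eq,
    Nat.cast_sub Fintype.card_pos, Nat.cast_one]

omit [DecidableEq Ω] in
lemma card_profile_apply_ne_zero (b : Ω → κ) (r : κ) :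
    ((univ.filter fun t : Profile b => t r ≠ 0).card : ℝ) =
      ((block b r).card : ℝ) / (1 + (block b r).card) * ∏ s, (1 + ((block b s).card : ℝ)) := by
  have h : (univ.filter fun t : Profile b => t r ≠ 0) =
      Fintype.piFinset fun s => univ.filter fun x : Fin ((block b s).card + 1) =>
        s = r → x ≠ 0 := by
    ext t
    simp only [mem_filter, mem_univ, true_and, Fintype.mem_piFinset]
    exact ⟨fun h s hs => hs ▸ h, fun h => h r rfl⟩
  have h' := prod_ite_eq' univ r fun s => ((block b s).card : ℝ) / (1 + (block b s).card)
  rw [if_pos (mem_univ r)] at h'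
  rw [h, Fintype.card_piFinset, Nat.cast_prod, ← h', ← prod_mul_distrib]
  refine prod_congr rfl fun s _ => ?_
  have hs : (1 + ((block b s).card : ℝ)) ≠ 0 := by positivity
  split_ifs with hsr
  · rw [div_mul_cancel₀ _ hs]
    simp [hsr, filter_ne']
  · simp [hsr, add_comm]

omit [DecidableEq Ω] in
lemma card_share (b : Ω → κ) :
    (Fintype.card (Share b) : ℝ) =
      (∑ r, ((block b r).card : ℝ) / (1 + (block b r).card)) *
        ∏ r, (1 + ((block b r).card : ℝ)) := by
  have h : Fintype.card (Share b) = ∑ r, (univ.filter fun t : Profile b => t r ≠ 0).card := by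
    rw [Fintype.card_subtype, ← card_sigma]
    refine card_bij' (fun p _ => ⟨p.2, p.1⟩) (fun p _ => (p.2, p.1)) ?_ ?_ ?_ ?_ <;> simp
  rw [h, Nat.cast_sum, sum_mul]
  exact sum_congr rfl fun r _ => card_profile_apply_ne_zero b r

lemma mem_casteGroup_block_iff {k : ℕ} (b : Ω → Fin k) (g : Equiv.Perm Ω) :
    g ∈ casteGroup (block b) ↔ ∀ i, b (g i) = b i := by
  change (∀ r, (block b r).image g = block b r) ↔ _
  constructor
  · intro h i
    have : g i ∈ (block b (b i)).image g := mem_image_of_mem g (by simp)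
    rw [h] at this
    simpa using this
  · intro h r
    refine eq_of_subset_of_card_le ?_ (card_image_of_injective _ g.injective).ge
    intro j hj
    obtain ⟨i, hi, rfl⟩ := mem_image.1 hj
    simpa [h] using hi

lemma isGSym_casteGroup_block_iff {k : ℕ} (b : Ω → Fin k) (φ : GameValue Ω) :
    IsGSym (casteGroup (block b)) φ ↔ ∀ g : Equiv.Perm Ω, (∀ i, b (g i) = b i) →
      ∀ (v : GameSpace Ω) (i : Ω), φ (permGame g v) (g i) = φ v i := by
  simp only [IsGSym, mem_casteGroup_block_iff]
  refine forall₃_congr fun g _ v => ⟨fun h i => by simpa using h (g i), fun h i => ?_⟩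
  simpa using h (g⁻¹ i)

lemma finrank_direction_block {k : ℕ} (b : Ω → Fin k) :
    (Module.finrank ℝ (affineSpan ℝ
        {φ : GameValue Ω | IsQuasiValue φ ∧ IsGSym (casteGroup (block b)) φ}).direction : ℝ) =
      ((∑ r, ((block b r).card : ℝ) / (1 + (block b r).card)) - 1) *
        (∏ r, (1 + ((block b r).card : ℝ))) + 1 := by
  have hset : {φ : GameValue Ω | IsQuasiValue φ ∧ IsGSym (casteGroup (block b)) φ} =
      shareValue b '' {d | totalShare b d = 1} := by
    rw [← setOf_isQuasiValue_symmetric_eq_image]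
    simp only [isGSym_casteGroup_block_iff]
  rw [hset]
  have h : ((_ + _ : ℕ) : ℝ) = _ := congrArg Nat.cast (finrank_direction_add_card b)
  rw [Nat.cast_add, card_profile_ne_zero, card_share] at h
  linarith

end QuasiValue

/-- for the "caste" group `G₂` of permutations preserving each
block of a partition `Ω = Ω₁ ∪ … ∪ Ω_k`, the dimension of `𝒜_{G₂}` equals
`(∑_r |Ω_r|/(1+|Ω_r|) - 1)·∏_r (1+|Ω_r|) + 1`; in particular for `k = 2` it is
`|Ω₁|·|Ω₂|`. -/
theorem stmt18 {Ω : Type*} [Fintype Ω] [DecidableEq Ω] {k : ℕ}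
    (P : Fin k → Finset Ω) (hne : ∀ r, (P r).Nonempty)
    (hdisj : ∀ r s, r ≠ s → Disjoint (P r) (P s))
    (hcover : Finset.univ.biUnion P = Finset.univ) :
    ((Module.finrank ℝ (affineSpan ℝ
        {φ : GameValue Ω | IsQuasiValue φ ∧ IsGSym (casteGroup P) φ}).direction : ℝ) =
      ((∑ r, ((P r).card : ℝ) / (1 + (P r).card)) - 1) *
        (∏ r, (1 + ((P r).card : ℝ))) + 1) ∧
    (∀ hk : k = 2,
      Module.finrank ℝ (affineSpan ℝ
          {φ : GameValue Ω | IsQuasiValue φ ∧ IsGSym (casteGroup P) φ}).direction =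
        (P ⟨0, by omega⟩).card * (P ⟨1, by omega⟩).card) := by
  have hex : ∀ i, ∃ r, i ∈ P r := fun i => by
    have hi : i ∈ Finset.univ.biUnion P := hcover ▸ Finset.mem_univ i
    simpa using hi
  choose b hb using hex
  have hP : P = QuasiValue.block b := by
    funext r
    ext i
    simp only [Finset.mem_filter, Finset.mem_univ, true_and]
    refine ⟨fun hi => ?_, fun hi => hi ▸ hb i⟩
    by_contra hne
    exact Finset.disjoint_left.1 (hdisj _ _ hne) (hb i) hi
  have main := QuasiValue.finrank_direction_block b
  rw [← hP] at main
  refine ⟨main, ?_⟩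
  rintro rfl
  have h : ∀ r, (1 + ((P r).card : ℝ)) ≠ 0 := fun r => by positivity
  have h0 := h 0
  have h1 := h 1
  rw [Fin.sum_univ_two, Fin.prod_univ_two] at main
  rw [← Nat.cast_inj (R := ℝ), main]
  change _ = (((P 0).card * (P 1).card : ℕ) : ℝ)
  push_cast
  field_simp
  ring
end
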